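/- If n ≥ 3 is even, then the spread spd(A_α) = μ₁(A_α) − μ_n(A_α) satisfies spd(A_α) ≥ (2/n)·√( (nα²/2)(Δ − δ)² + (2n²α²/(n−2))(2m/n − (Δ+δ)/2)² + 2mn(1−α)² ). -/

import Mathlib

open Finset

theorem card_mul_sum_sq_sub_sq_sum_le {ι : Type*} [Fintype ι] (x : ι → ℝ) (a b : ℝ)
    (ha : ∀ i, a ≤ x i) (hb : ∀ i, x i ≤ b) :
    4 * (Fintype.card ι * ∑ i, x i ^ 2 - (∑ i, x i) ^ 2) ≤ (Fintype.card ι) ^ 2 * (b - a) ^ 2 := by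
  have hi : ∑ i, x i ^ 2 ≤ ∑ i, ((a + b) * x i - a * b) :=
    sum_le_sum fun i _ => by nlinarith [mul_nonneg (sub_nonneg.2 (ha i)) (sub_nonneg.2 (hb i))]
  rw [sum_sub_distrib, ← mul_sum, sum_const, card_univ, nsmul_eq_mul] at hi
  have hc : (0 : ℝ) ≤ Fintype.card ι := Nat.cast_nonneg _
  nlinarith [mul_le_mul_of_nonneg_left hi hc,
    sq_nonneg (2 * ∑ i, x i - Fintype.card ι * (a + b))]

theorem sq_sub_add_sq_le_sum_sq {ι : Type*} [Fintype ι] [DecidableEq ι] (x : ι → ℝ) {p q : ι}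
    (hpq : p ≠ q) :
    2 * (Fintype.card ι - 2 : ℝ) * (x p ^ 2 + x q ^ 2) + 2 * (∑ i, x i - x p - x q) ^ 2 ≤
      2 * (Fintype.card ι - 2 : ℝ) * ∑ i, x i ^ 2 := by
  set s : Finset ι := (univ.erase p).erase q
  have hq : q ∈ univ.erase p := by simp [hpq.symm]
  have hcard : ((#s : ℕ) : ℝ) = Fintype.card ι - 2 := by
    have h₁ := card_erase_add_one hq
    have h₂ := card_erase_add_one (mem_univ p)
    rw [card_univ] at h₂
    rw [← h₂, ← h₁]
    push_cast
    ring
  have hsum (f : ι → ℝ) : ∑ i ∈ s, f i = ∑ i, f i - f p - f q := by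
    rw [← add_sum_erase univ f (mem_univ p), ← add_sum_erase _ f hq]
    ring
  have h := sq_sum_le_card_mul_sum_sq (s := s) (f := x)
  rw [hsum x, hsum (fun i => x i ^ 2), hcard] at h
  linarith

theorem Matrix.IsHermitian.sum_eigenvalues_sq {ι : Type*} [Fintype ι] [DecidableEq ι]
    {A : Matrix ι ι ℂ} (hA : A.IsHermitian) :
    ∑ i, hA.eigenvalues i ^ 2 = ∑ i, ∑ j, Complex.normSq (A i j) := by
  have h₁ : (A * A).trace = ∑ i, (hA.eigenvalues i : ℂ) ^ 2 := by
    have h := hA.spectral_theorem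
    have h' : A * A = Unitary.conjStarAlgAut ℂ _ hA.eigenvectorUnitary
        (diagonal (RCLike.ofReal ∘ hA.eigenvalues) * diagonal (RCLike.ofReal ∘ hA.eigenvalues)) := by
      rw [map_mul, ← h]
    rw [h', Unitary.conjStarAlgAut_apply, Matrix.trace_mul_comm, ← Matrix.mul_assoc]
    simp [Matrix.trace, pow_two]
  have h₂ : (A * A).trace = ∑ i, ∑ j, (Complex.normSq (A i j) : ℂ) := by
    simp only [Matrix.trace, Matrix.diag, Matrix.mul_apply]
    refine sum_congr rfl fun i _ => sum_congr rfl fun j _ => ?_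
    rw [Complex.normSq_eq_conj_mul_self, mul_comm, ← hA.apply j i]
    rfl
  exact_mod_cast h₁.symm.trans h₂

theorem SimpleGraph.le_sum_degree_sq_sub_sq_div {V : Type*} [Fintype V] (G : SimpleGraph V)
    [DecidableRel G.Adj] (hV : 2 < Fintype.card V) :
    (G.maxDegree - G.minDegree : ℝ) ^ 2 / 2 + 2 * Fintype.card V / (Fintype.card V - 2) *
      ((∑ v, (G.degree v : ℝ)) / Fintype.card V - (G.maxDegree + G.minDegree) / 2) ^ 2 ≤
      ∑ v, (G.degree v : ℝ) ^ 2 - (∑ v, (G.degree v : ℝ)) ^ 2 / Fintype.card V := by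
  classical
  have : Nonempty V := Fintype.card_pos_iff.1 (by omega)
  obtain ⟨p, hp⟩ := G.exists_maximal_degree_vertex
  obtain ⟨q, hq⟩ := G.exists_minimal_degree_vertex
  have hc : (2 : ℝ) < Fintype.card V := by exact_mod_cast hV
  by_cases h : p = q
  · have hd (v : V) : (G.degree v : ℝ) = G.maxDegree := by
      have h₁ := G.degree_le_maxDegree v
      have h₂ := G.minDegree_le_degree v
      subst h
      exact_mod_cast (by omega : G.degree v = G.maxDegree)
    have hm : (G.minDegree : ℝ) = G.maxDegree := by rw [hq, hd]
    simp only [hd, hm, sum_const, card_univ, nsmul_eq_mul]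
    field_simp
    ring_nf
    rfl
  · have key := sq_sub_add_sq_le_sum_sq (fun v => (G.degree v : ℝ)) h
    simp only [← hp, ← hq] at key
    have hc₂ : (0 : ℝ) < Fintype.card V - 2 := by linarith
    generalize (Fintype.card V : ℝ) = N at *
    generalize ∑ v, (G.degree v : ℝ) ^ 2 = Q at *
    generalize ∑ v, (G.degree v : ℝ) = S at *
    generalize (G.maxDegree : ℝ) = a at *
    generalize (G.minDegree : ℝ) = b at *
    have hN : N ≠ 0 := by linarith
    have e : (a - b) ^ 2 / 2 + 2 * N / (N - 2) * (S / N - (a + b) / 2) ^ 2 =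
        (2 * (N - 2) * (a ^ 2 + b ^ 2) + 2 * (S - a - b) ^ 2) / (2 * (N - 2)) - S ^ 2 / N := by
      field_simp
      ring
    rw [e]
    gcongr
    rw [div_le_iff₀ (by linarith)]
    linarith

theorem normSq_eq_one_of_eq_one_or_sixth_root {z : ℂ}
    (hz : z = 1 ∨ z = ((1 + Real.sqrt 3 * Complex.I) / 2 : ℂ) ∨
    z = (starRingEnd ℂ) ((1 + Real.sqrt 3 * Complex.I) / 2 : ℂ)) : Complex.normSq z = 1 := by
  have h3 : Real.sqrt 3 * Real.sqrt 3 = 3 := Real.mul_self_sqrt (by norm_num)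
  have hω : Complex.normSq ((1 + Real.sqrt 3 * Complex.I) / 2 : ℂ) = 1 := by
    rw [Complex.normSq_div]
    simp [Complex.normSq_apply, h3]
    norm_num
  rcases hz with rfl | rfl | rfl
  · simp
  · exact hω
  · rw [Complex.normSq_conj, hω]

theorem stmt_15
    (n m : ℕ) (hn : 3 ≤ n)
    (G : SimpleGraph (Fin n)) [DecidableRel G.Adj]
    (hm : G.edgeFinset.card = m)
    (H : Matrix (Fin n) (Fin n) ℂ) (hHherm : H.IsHermitian)
    (hHdiag : ∀ v, H v v = 0)
    (hHzero : ∀ v u, v ≠ u → ¬ G.Adj v u → H v u = 0)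
    (hHedge : ∀ v u, G.Adj v u →
      H v u = 1 ∨ H v u = ((1 + Real.sqrt 3 * Complex.I) / 2 : ℂ) ∨ H v u = (starRingEnd ℂ) ((1 + Real.sqrt 3 * Complex.I) / 2 : ℂ))
    (α : ℝ) (hα : α ∈ Set.Icc (0 : ℝ) 1)
    (A : Matrix (Fin n) (Fin n) ℂ)
    (hA : A = (α : ℂ) • Matrix.diagonal (fun i => (G.degree i : ℂ)) + ((1 - α : ℝ) : ℂ) • H)
    (hAherm : A.IsHermitian)
    (μ : Fin n → ℝ) (hmono : Antitone μ)
    (hperm : ∃ e : Equiv.Perm (Fin n), μ = hAherm.eigenvalues ∘ e)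
    (heven : Even n) :
    μ ⟨0, by omega⟩ - μ ⟨n - 1, by omega⟩ ≥ (2 / (n : ℝ)) * Real.sqrt ((n : ℝ) * α ^ 2 / 2 * ((G.maxDegree : ℝ) - (G.minDegree : ℝ)) ^ 2 + 2 * (n : ℝ) ^ 2 * α ^ 2 / ((n : ℝ) - 2) * (2 * (m : ℝ) / n - ((G.maxDegree : ℝ) + (G.minDegree : ℝ)) / 2) ^ 2 + 2 * (m : ℝ) * n * (1 - α) ^ 2) := by
  have hn₂ : (2 : ℝ) < n := by exact_mod_cast hn
  have hn₀ : (0 : ℝ) < n := by linarith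
  have hdeg : ∑ v, (G.degree v : ℝ) = 2 * m := by
    exact_mod_cast hm ▸ G.sum_degrees_eq_twice_card_edges
  have hAdiag (i : Fin n) : A i i = (α * G.degree i : ℝ) := by
    simp [hA, hHdiag]
  have hAoff (i j : Fin n) (hij : i ≠ j) :
      Complex.normSq (A i j) = (1 - α) ^ 2 * if G.Adj i j then 1 else 0 := by
    have : A i j = ((1 - α : ℝ) : ℂ) * H i j := by
      simp [hA, Matrix.diagonal_apply_ne _ hij]
    rw [this, map_mul, Complex.normSq_ofReal, ← pow_two]
    split_ifs with h
    · rw [normSq_eq_one_of_eq_one_or_sixth_root (hHedge i j h)]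
    · rw [hHzero i j hij h, map_zero]
  have hrow (i : Fin n) : ∑ j, Complex.normSq (A i j) =
      α ^ 2 * (G.degree i : ℝ) ^ 2 + (1 - α) ^ 2 * G.degree i := by
    have hd : (G.degree i : ℝ) = ∑ j ∈ univ.erase i, if G.Adj i j then (1 : ℝ) else 0 := by
      rw [sum_erase _ (by simp), sum_boole, ← G.card_neighborFinset_eq_degree,
        G.neighborFinset_eq_filter]
    rw [← add_sum_erase _ _ (mem_univ i), sum_congr rfl fun j hj =>
      hAoff i j (ne_of_mem_erase hj).symm, ← mul_sum, ← hd, hAdiag, Complex.normSq_ofReal]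
    ring
  obtain ⟨e, he⟩ := hperm
  have hμ₁ : ∑ i, μ i = α * (2 * m) := by
    have h : A.trace = ((∑ i, μ i : ℝ) : ℂ) := by
      rw [hAherm.trace_eq_sum_eigenvalues, he]
      simp only [Function.comp_apply, Equiv.sum_comp e hAherm.eigenvalues]
      simp
    rw [← hdeg, mul_sum]
    apply Complex.ofReal_injective
    rw [← h, Complex.ofReal_sum]
    exact sum_congr rfl fun i _ => hAdiag i
  have hμ₂ : ∑ i, μ i ^ 2 = α ^ 2 * ∑ i, (G.degree i : ℝ) ^ 2 + (1 - α) ^ 2 * (2 * m) := by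
    rw [he]
    simp only [Function.comp_apply]
    rw [Equiv.sum_comp e fun i => hAherm.eigenvalues i ^ 2, hAherm.sum_eigenvalues_sq]
    simp only [hrow]
    rw [sum_add_distrib, ← mul_sum, ← mul_sum, hdeg]
  have hspread := card_mul_sum_sq_sub_sq_sum_le μ (μ ⟨n - 1, by omega⟩) (μ ⟨0, by omega⟩)
    (fun i => hmono (Fin.le_def.2 (by dsimp; omega)))
    (fun i => hmono (Fin.le_def.2 (Nat.zero_le _)))
  have hnonneg : 0 ≤ μ ⟨0, by omega⟩ - μ ⟨n - 1, by omega⟩ :=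
    sub_nonneg.2 (hmono (Fin.le_def.2 (Nat.zero_le _)))
  have hvar := G.le_sum_degree_sq_sub_sq_div (by rw [Fintype.card_fin]; omega)
  rw [Fintype.card_fin, hdeg] at hvar
  rw [Fintype.card_fin, hμ₁, hμ₂] at hspread
  rw [ge_iff_le, div_mul_eq_mul_div, div_le_iff₀ hn₀, ← le_div_iff₀' two_pos]
  refine Real.sqrt_le_iff.2 ⟨by positivity, ?_⟩
  have hscaled := mul_le_mul_of_nonneg_left hvar (by positivity : 0 ≤ (n : ℝ) * α ^ 2)
  have hS : (n : ℝ) * α ^ 2 * ((2 * m : ℝ) ^ 2 / n) = (α * (2 * m)) ^ 2 := by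
    field_simp
  rw [mul_sub, hS] at hscaled
  have hT : (n : ℝ) * α ^ 2 / 2 * ((G.maxDegree : ℝ) - G.minDegree) ^ 2 +
      2 * (n : ℝ) ^ 2 * α ^ 2 / (n - 2) *
        (2 * (m : ℝ) / n - ((G.maxDegree : ℝ) + G.minDegree) / 2) ^ 2 =
      n * α ^ 2 * (((G.maxDegree : ℝ) - G.minDegree) ^ 2 / 2 +
        2 * n / (n - 2) * (2 * m / n - ((G.maxDegree : ℝ) + G.minDegree) / 2) ^ 2) := by
    ring
  rw [hT]
  linarith
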